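/- For every n ≥ 1 there exists a bijection φ from the set D_n of Dyck paths of length n onto the set NC(n) of non-crossing permutations of {1,…,n} such that for every w ∈ D_n both des(w) + des(φ(w)) = n − 1 and maj(w) + maj(φ(w)) + imaj(φ(w)) = n(n−1). -/

import Mathlib

open scoped Classical

namespace Stmt

/-- Number of north steps (`true`) among the first `k` steps of the path `w`. -/
def countN {m : ℕ} (w : Fin m → Bool) (k : ℕ) : ℕ :=
  (Finset.univ.filter (fun t : Fin m => (t : ℕ) < k ∧ w t = true)).card

/-- Number of east steps (`false`) among the first `k` steps of the path `w`. -/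
def countE {m : ℕ} (w : Fin m → Bool) (k : ℕ) : ℕ :=
  (Finset.univ.filter (fun t : Fin m => (t : ℕ) < k ∧ w t = false)).card

/-- A Dyck path of length `n`: `n` north and `n` east steps, every prefix has
at least as many north as east steps. -/
def IsDyckA (n : ℕ) (w : Fin (2 * n) → Bool) : Prop :=
  countN w (2 * n) = n ∧ ∀ k : ℕ, countE w k ≤ countN w k

/-- A Dyck path of type `B_n`: `2n` steps, every prefix has at least as many
north as east steps. -/
def IsDyckB (n : ℕ) (w : Fin (2 * n) → Bool) : Prop :=
  ∀ k : ℕ, countE w k ≤ countN w k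

/-- The unit cell `[i-1,i] × [j-1,j]` lies below the lattice path `w`:
at some time the path has `x`-coordinate `< i` and `y`-coordinate `≥ j`. -/
def CellBelow {m : ℕ} (w : Fin m → Bool) (i j : ℕ) : Prop :=
  ∃ k : ℕ, countE w k < i ∧ j ≤ countN w k

/-- Area of a (type `A`) Dyck path: number of cells `b_{i,j}` with `i < j`
lying below the path. -/
noncomputable def areaA {m : ℕ} (w : Fin m → Bool) : ℕ :=
  {p : ℕ × ℕ | 1 ≤ p.1 ∧ p.1 < p.2 ∧ CellBelow w p.1 p.2}.ncard

/-- Area of a type `B_n` Dyck path: number of cells `b_{i,j}` with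
`1 ≤ i < j ≤ 2n+1-i` lying below the path. -/
noncomputable def areaB (n : ℕ) (w : Fin (2 * n) → Bool) : ℕ :=
  {p : ℕ × ℕ | 1 ≤ p.1 ∧ p.1 < p.2 ∧ p.2 ≤ 2 * n + 1 - p.1 ∧
    CellBelow w p.1 p.2}.ncard

/-- Descent set of a path, 1-indexed: positions `i` with `w_i = E`, `w_{i+1} = N`. -/
def pathDes {m : ℕ} (w : Fin m → Bool) : Finset ℕ :=
  (Finset.Ioo 0 m).filter (fun i =>
    ∃ h : i < m, w ⟨i - 1, Nat.lt_of_le_of_lt (Nat.sub_le i 1) h⟩ = false ∧ w ⟨i, h⟩ = true)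

def desPath {m : ℕ} (w : Fin m → Bool) : ℕ := (pathDes w).card

/-- Major index of a Dyck path of length `n`: `maj(w) = ∑_{i ∈ Des(w)} (2n - i)`. -/
def majA (n : ℕ) (w : Fin (2 * n) → Bool) : ℕ :=
  ∑ i ∈ pathDes w, (2 * n - i)

/-- Number of east steps of a path. -/
def negPath {m : ℕ} (w : Fin m → Bool) : ℕ :=
  (Finset.univ.filter (fun t : Fin m => w t = false)).card

/-- Type `B` major index: `maj(w) = 2 ⬝ (neg(w) + ∑_{i ∈ Des(w)} (2n - i))`. -/
def majB (n : ℕ) (w : Fin (2 * n) → Bool) : ℕ :=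
  2 * (negPath w + ∑ i ∈ pathDes w, (2 * n - i))

/-- Number of inversions of a permutation of `{1,…,n}`. -/
def invP {n : ℕ} (σ : Equiv.Perm (Fin n)) : ℕ :=
  (Finset.univ.filter (fun p : Fin n × Fin n => p.1 < p.2 ∧ σ p.2 < σ p.1)).card

/-- Descent set of a permutation, as 1-indexed positions in `{1,…,n-1}`. -/
def permDes {n : ℕ} (σ : Equiv.Perm (Fin n)) : Finset ℕ :=
  (Finset.Ico 1 n).filter (fun i =>
    ∃ h : i < n, σ ⟨i, h⟩ < σ ⟨i - 1, Nat.lt_of_le_of_lt (Nat.sub_le i 1) h⟩)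

def desP {n : ℕ} (σ : Equiv.Perm (Fin n)) : ℕ := (permDes σ).card

def majP {n : ℕ} (σ : Equiv.Perm (Fin n)) : ℕ := ∑ i ∈ permDes σ, i

def imajP {n : ℕ} (σ : Equiv.Perm (Fin n)) : ℕ := majP σ⁻¹

/-- Every orbit of `σ` is an increasing cycle: each element is mapped to the
next larger element of its orbit, the largest being mapped to the smallest. -/
def IncCycles {n : ℕ} (σ : Equiv.Perm (Fin n)) : Prop :=
  ∀ x : Fin n,
    ((∃ y, σ.SameCycle x y ∧ x < y) →
      x < σ x ∧ ∀ y, σ.SameCycle x y → x < y → σ x ≤ y) ∧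
    ((∀ y, σ.SameCycle x y → y ≤ x) → ∀ y, σ.SameCycle x y → σ x ≤ y)

/-- No two distinct orbits of `σ` cross. -/
def NoCrossing {n : ℕ} (σ : Equiv.Perm (Fin n)) : Prop :=
  ¬ ∃ a b c d : Fin n, a < b ∧ b < c ∧ c < d ∧
      σ.SameCycle a c ∧ σ.SameCycle b d ∧ ¬σ.SameCycle a b

/-- Non-crossing permutations of `{1,…,n}`. -/
def IsNC {n : ℕ} (σ : Equiv.Perm (Fin n)) : Prop := IncCycles σ ∧ NoCrossing σ


/-! ### Non-crossing matchings of the letters of a word -/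

/-- `A` is a non-crossing matching whose left endpoints are the positions in `N` and whose right
endpoints are the positions in `E`. -/
structure IsNCMatching (N E : ℕ → Prop) (A : ℕ → ℕ → Prop) : Prop where
  lt : ∀ {p q}, A p q → p < q
  right_unique : ∀ {p q q'}, A p q → A p q' → q = q'
  left_unique : ∀ {p p' q}, A p q → A p' q → p = p'
  nested : ∀ {p q p' q'}, A p q → A p' q' → p < p' → p' < q → q' < q
  left_iff : ∀ {p}, (∃ q, A p q) ↔ N p
  right_iff : ∀ {q}, (∃ p, A p q) ↔ E q

theorem IsNCMatching.of_shorter {N E : ℕ → Prop} {A A' : ℕ → ℕ → Prop}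
    (h : IsNCMatching N E A) (h' : IsNCMatching N E A') {p q : ℕ}
    (ih : ∀ p' q', q' - p' < q - p → (A p' q' ↔ A' p' q')) (hA : A p q) : A' p q := by
  obtain ⟨q', hq'⟩ := h'.left_iff.2 (h.left_iff.1 ⟨q, hA⟩)
  obtain ⟨p', hp'⟩ := h'.right_iff.2 (h.right_iff.1 ⟨p, hA⟩)
  have hpq := h.lt hA
  have hpq' := h'.lt hq'
  have hp'q := h'.lt hp'
  rcases lt_trichotomy q' q with hlt | rfl | hgt
  · have := h.right_unique hA ((ih p q' (by omega)).2 hq')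
    omega
  · exact hq'
  · rcases lt_trichotomy p' p with hl | rfl | hg
    · have := h'.nested hp' hq' hl hpq
      omega
    · exact hp'
    · have := h.left_unique hA ((ih p' q (by omega)).2 hp')
      omega

theorem IsNCMatching.unique {N E : ℕ → Prop} {A A' : ℕ → ℕ → Prop}
    (h : IsNCMatching N E A) (h' : IsNCMatching N E A') (p q : ℕ) : A p q ↔ A' p q := by
  induction hd : q - p using Nat.strong_induction_on generalizing p q with
  | _ d ih =>
    subst hd
    exact ⟨h.of_shorter h' fun p' q' hlt => ih _ hlt p' q' rfl,
      h'.of_shorter h fun p' q' hlt => (ih _ hlt p' q' rfl).symm⟩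

/-- The positions of the letter `b` in the word `w`. -/
def HasLetter {m : ℕ} (w : Fin m → Bool) (b : Bool) (p : ℕ) : Prop :=
  ∃ h : p < m, w ⟨p, h⟩ = b

theorem HasLetter.not_true {m : ℕ} {w : Fin m → Bool} {p : ℕ} (h : HasLetter w false p) :
    ¬ HasLetter w true p := by
  rintro ⟨_, htrue⟩
  obtain ⟨_, hfalse⟩ := h
  simp [hfalse] at htrue

/-! ### Existence of the matching of a Dyck path -/

theorem countN_zero {m : ℕ} (w : Fin m → Bool) : countN w 0 = 0 := by
  simp [countN]

theorem countE_zero {m : ℕ} (w : Fin m → Bool) : countE w 0 = 0 := by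
  simp [countE]

theorem card_filter_lt_succ {m : ℕ} (w : Fin m → Bool) (b : Bool) {k : ℕ} (hk : k < m) :
    (Finset.univ.filter (fun t : Fin m => (t : ℕ) < k + 1 ∧ w t = b)).card =
      (Finset.univ.filter (fun t : Fin m => (t : ℕ) < k ∧ w t = b)).card +
        if w ⟨k, hk⟩ = b then 1 else 0 := by
  split_ifs with h
  · rw [← Finset.card_insert_of_notMem (a := (⟨k, hk⟩ : Fin m)) (by simp)]
    congr 1
    ext t
    simp only [Finset.mem_filter, Finset.mem_univ, true_and, Finset.mem_insert, Fin.ext_iff]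
    constructor
    · rintro ⟨h1, h2⟩
      by_cases h3 : (t : ℕ) = k
      · exact .inl h3
      · exact .inr ⟨by omega, h2⟩
    · rintro (h1 | ⟨h1, h2⟩)
      · obtain rfl : t = ⟨k, hk⟩ := Fin.ext h1
        exact ⟨by simp, h⟩
      · exact ⟨by omega, h2⟩
  · rw [add_zero]
    congr 1
    ext t
    simp only [Finset.mem_filter, Finset.mem_univ, true_and]
    refine ⟨?_, fun ⟨h1, h2⟩ => ⟨by omega, h2⟩⟩
    rintro ⟨h1, h2⟩
    refine ⟨?_, h2⟩
    by_contra h3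
    obtain rfl : t = ⟨k, hk⟩ := Fin.ext (by simp; omega)
    exact h h2

/-- The height of the path `w` after `k` steps. -/
def height {m : ℕ} (w : Fin m → Bool) (k : ℕ) : ℤ := (countN w k : ℤ) - countE w k

theorem height_zero {m : ℕ} (w : Fin m → Bool) : height w 0 = 0 := by
  simp [height, countN_zero, countE_zero]

theorem height_succ {m : ℕ} (w : Fin m → Bool) {k : ℕ} (hk : k < m) :
    height w (k + 1) = height w k + if w ⟨k, hk⟩ = true then 1 else -1 := by
  have hN : countN w (k + 1) = _ := card_filter_lt_succ w true hk
  have hE : countE w (k + 1) = _ := card_filter_lt_succ w false hk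
  unfold height
  rw [hN, hE, ← countN, ← countE]
  cases w ⟨k, hk⟩ <;> simp <;> ring

theorem height_succ_of_true {m : ℕ} {w : Fin m → Bool} {k : ℕ} (h : HasLetter w true k) :
    height w (k + 1) = height w k + 1 := by
  obtain ⟨hk, h⟩ := h
  simp [height_succ w hk, h]

theorem height_succ_of_false {m : ℕ} {w : Fin m → Bool} {k : ℕ} (h : HasLetter w false k) :
    height w (k + 1) = height w k - 1 := by
  obtain ⟨hk, h⟩ := h
  simp [height_succ w hk, h, sub_eq_add_neg]

theorem hasLetter_or {m : ℕ} (w : Fin m → Bool) {k : ℕ} (hk : k < m) :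
    HasLetter w true k ∨ HasLetter w false k := by
  cases h : w ⟨k, hk⟩
  · exact .inr ⟨hk, h⟩
  · exact .inl ⟨hk, h⟩

theorem height_step {m : ℕ} (w : Fin m → Bool) {k : ℕ} (hk : k < m) :
    height w (k + 1) = height w k + 1 ∨ height w (k + 1) = height w k - 1 :=
  (hasLetter_or w hk).imp height_succ_of_true height_succ_of_false

theorem height_emod_two {m : ℕ} (w : Fin m → Bool) {k : ℕ} (hk : k ≤ m) :
    height w k % 2 = (k : ℤ) % 2 := by
  induction k with
  | zero => simp [height_zero]
  | succ k ih =>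
    have := ih (by omega)
    rcases height_step w (k := k) (by omega) with h | h <;> push_cast <;> omega

theorem countN_add_countE {m : ℕ} (w : Fin m → Bool) : countN w m + countE w m = m := by
  have h := Finset.card_filter_add_card_filter_not (s := (Finset.univ : Finset (Fin m)))
    (fun t => w t = true)
  simpa [countN, countE] using h

/-- The step at `p` goes up and the step at `q` is the first one afterwards leading back to the
height from which the step at `p` starts. -/
def HeightArc {m : ℕ} (w : Fin m → Bool) (p q : ℕ) : Prop :=
  p < q ∧ q < m ∧ height w (q + 1) = height w p ∧ ∀ k, p < k → k ≤ q → height w p < height w k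

theorem HeightArc.parity {m : ℕ} {w : Fin m → Bool} {p q : ℕ} (h : HeightArc w p q) :
    q % 2 ≠ p % 2 := by
  obtain ⟨h1, h2, h3, -⟩ := h
  have e1 := height_emod_two w (k := q + 1) (by omega)
  have e2 := height_emod_two w (k := p) (by omega)
  rw [h3, e2] at e1
  push_cast at e1
  omega

theorem isNCMatching_heightArc {n : ℕ} {w : Fin (2 * n) → Bool} (hw : IsDyckA n w) :
    IsNCMatching (HasLetter w true) (HasLetter w false) (HeightArc w) where
  lt h := h.1
  right_unique := by
    rintro p q q' ⟨h1, h2, h3, h4⟩ ⟨h1', h2', h3', h4'⟩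
    by_contra hne
    rcases Nat.lt_or_gt_of_ne hne with h | h
    · have := h4' (q + 1) (by omega) (by omega)
      omega
    · have := h4 (q' + 1) (by omega) (by omega)
      omega
  left_unique := by
    rintro p p' q ⟨h1, h2, h3, h4⟩ ⟨h1', h2', h3', h4'⟩
    by_contra hne
    rcases Nat.lt_or_gt_of_ne hne with h | h
    · have := h4 p' (by omega) (by omega)
      omega
    · have := h4' p (by omega) (by omega)
      omega
  nested := by
    rintro p q p' q' ⟨h1, h2, h3, h4⟩ ⟨h1', h2', h3', h4'⟩ hp hq
    by_contra hle
    have := h4 p' hp hq.le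
    rcases Nat.lt_or_eq_of_le (Nat.le_of_not_lt hle) with h | h
    · have := h4' (q + 1) (by omega) (by omega)
      omega
    · subst h
      omega
  left_iff := by
    intro p
    constructor
    · rintro ⟨q, h1, h2, h3, h4⟩
      rcases hasLetter_or w (k := p) (by omega) with h | h
      · exact h
      · have := height_succ_of_false h
        have := h4 (p + 1) (by omega) (by omega)
        omega
    · intro h
      have hup := height_succ_of_true h
      obtain ⟨hp, -⟩ := h
      have hend : height w (2 * n) ≤ height w p := by
        have e := countN_add_countE w
        have e' := hw.2 p
        have e'' := hw.1
        unfold height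
        omega
      have hex : ∃ k, p < k ∧ height w k ≤ height w p := ⟨2 * n, hp, hend⟩
      have hmin := fun k => Nat.find_min hex (m := k)
      have hle := Nat.find_min' hex ⟨hp, hend⟩
      obtain ⟨hs1, hs2⟩ := Nat.find_spec hex
      generalize Nat.find hex = k at *
      obtain ⟨q, rfl⟩ : ∃ q, k = q + 1 := ⟨k - 1, by omega⟩
      have hpq : p < q := by
        rcases Nat.lt_or_eq_of_le (Nat.le_of_lt_succ hs1) with h | h
        · exact h
        · subst h
          omega
      have habove : ∀ k, p < k → k ≤ q → height w p < height w k := by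
        intro k hk hk'
        by_contra hcon
        exact hmin k (by omega) ⟨hk, by omega⟩
      refine ⟨q, hpq, by omega, ?_, habove⟩
      have := habove q hpq le_rfl
      rcases height_step w (k := q) (by omega) with h | h <;> omega
  right_iff := by
    intro q
    constructor
    · rintro ⟨p, h1, h2, h3, h4⟩
      rcases hasLetter_or w (k := q) (by omega) with h | h
      · have := height_succ_of_true h
        have := h4 q (by omega) (by omega)
        omega
      · exact h
    · intro h
      have hdown := height_succ_of_false h
      obtain ⟨hq, -⟩ := h
      have hstart : height w 0 ≤ height w (q + 1) := by
        have e := hw.2 (q + 1)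
        rw [height_zero]
        unfold height
        omega
      have hspec := Nat.findGreatest_spec (P := fun k => height w k ≤ height w (q + 1))
        (Nat.zero_le q) hstart
      have hle := Nat.findGreatest_le (P := fun k => height w k ≤ height w (q + 1)) q
      have hmax := fun k => Nat.findGreatest_is_greatest
        (P := fun k => height w k ≤ height w (q + 1)) (n := q) (k := k)
      generalize Nat.findGreatest (fun k => height w k ≤ height w (q + 1)) q = p at *
      have hpq : p < q := by
        rcases Nat.lt_or_eq_of_le hle with h | h
        · exact h
        · subst h
          omega
      have habove : ∀ k, p < k → k ≤ q → height w (q + 1) < height w k := by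
        intro k hk hk'
        have := hmax k hk hk'
        omega
      have heq : height w (q + 1) = height w p := by
        have := habove (p + 1) (by omega) (by omega)
        rcases height_step w (k := p) (by omega) with h | h <;> omega
      exact ⟨p, hpq, hq, heq, fun k hpk hkq => heq ▸ habove k hpk hkq⟩

/-! ### Non-crossing permutations in terms of their arcs -/

/-- The arcs `{i, σ i}` of `σ`, both the ascending and the closing ones, are nested. -/
structure ArcsNested {n : ℕ} (σ : Equiv.Perm (Fin n)) : Prop where
  exc : ∀ {i x}, i < x → x < σ i → i < σ x ∧ σ x < σ i
  exc_inv : ∀ {i x}, i < x → x < σ i → i < σ⁻¹ x ∧ σ⁻¹ x < σ i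
  ret : ∀ {i x}, σ i ≤ x → x < i → σ i < σ x ∧ σ x ≤ i
  ret_inv : ∀ {i x}, σ i < x → x ≤ i → σ i ≤ σ⁻¹ x ∧ σ⁻¹ x < i

theorem IsNC.arcsNested {n : ℕ} {σ : Equiv.Perm (Fin n)} (h : IsNC σ) : ArcsNested σ := by
  obtain ⟨hinc, hnc⟩ := h
  have hσ : ∀ x, σ.SameCycle x (σ x) := fun x => (Equiv.Perm.SameCycle.refl σ x).apply_right
  have hσ' : ∀ x, σ.SameCycle x (σ⁻¹ x) := fun x => by
    simpa using (hσ (σ⁻¹ x)).symm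
  have cross : ∀ {a b c d : Fin n}, σ.SameCycle a c → σ.SameCycle b d → ¬ σ.SameCycle a b →
      a < b → b < c → c < d → False := fun h1 h2 h3 h4 h5 h6 =>
    hnc ⟨_, _, _, _, h4, h5, h6, h1, h2, h3⟩
  have key : ∀ {i x y : Fin n}, σ.SameCycle x y → ¬ σ.SameCycle i x →
      ((i < x → x < σ i → i < y ∧ y < σ i) ∧ (σ i < x → x < i → σ i < y ∧ y < i)) := by
    intro i x y hxy hix
    have hiy : ¬ σ.SameCycle i y := fun h => hix (h.trans hxy.symm)
    have e1 : y ≠ i := by rintro rfl; exact hiy (.refl _ _)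
    have e2 : y ≠ σ i := by rintro rfl; exact hiy (hσ i)
    have hsx : ¬ σ.SameCycle (σ i) x := fun h => hix ((hσ i).trans h)
    constructor
    · intro h1 h2
      by_contra hcon
      rcases lt_or_gt_of_ne e1 with h | h
      · exact cross hxy.symm (hσ i) (fun h => hiy h.symm) h h1 h2
      · rcases lt_or_gt_of_ne e2 with h' | h'
        · exact hcon ⟨h, h'⟩
        · exact cross (hσ i) hxy hix h1 h2 h'
    · intro h1 h2
      by_contra hcon
      rcases lt_or_gt_of_ne e2 with h | h
      · exact cross hxy.symm (hσ i).symm (fun h => hiy ((hσ i).trans h.symm)) h h1 h2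
      · rcases lt_or_gt_of_ne e1 with h' | h'
        · exact hcon ⟨h, h'⟩
        · exact cross (hσ i).symm hxy hsx h1 h2 h'
  have hexc : ∀ {i x}, i < x → x < σ i → ¬ σ.SameCycle i x := fun {i x} h1 h2 h =>
    absurd (((hinc i).1 ⟨x, h, h1⟩).2 x h h1) (not_le.2 h2)
  have hmax : ∀ {i}, σ i ≤ i → ∀ y, σ.SameCycle i y → y ≤ i := by
    intro i hi y hy
    by_contra hlt
    exact absurd ((hinc i).1 ⟨y, hy, not_le.1 hlt⟩).1 (not_lt.2 hi)
  constructor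
  · intro i x h1 h2
    exact (key (hσ x) (hexc h1 h2)).1 h1 h2
  · intro i x h1 h2
    exact (key (hσ' x) (hexc h1 h2)).1 h1 h2
  · intro i x h1 h2
    by_cases hs : σ.SameCycle i x
    · have := (hinc x).1 ⟨i, hs.symm, h2⟩
      exact ⟨h1.trans_lt this.1, this.2 i hs.symm h2⟩
    · have hne : σ i ≠ x := by rintro rfl; exact hs (hσ i)
      have := (key (hσ x) hs).2 (lt_of_le_of_ne h1 hne) h2
      exact ⟨this.1, this.2.le⟩
  · intro i x h1 h2
    by_cases hs : σ.SameCycle i x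
    · have hs' := hs.trans (hσ' x)
      have hm := hmax (h1.le.trans h2)
      refine ⟨(hinc i).2 hm _ hs', lt_of_le_of_ne (hm _ hs') ?_⟩
      intro h
      rw [← h] at h1
      simp at h1
    · have hne : x ≠ i := by rintro rfl; exact hs (.refl _ _)
      have := (key (hσ' x) hs).2 h1 (lt_of_le_of_ne h2 hne)
      exact ⟨this.1.le, this.2⟩

theorem sameCycle_induction {α : Type*} [Finite α] {σ : Equiv.Perm α} {P : α → Prop}
    (hP : ∀ x, P x → P (σ x)) {x y : α} (h : σ.SameCycle x y) (hx : P x) : P y := by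
  obtain ⟨k, -, rfl⟩ := h.exists_pow_eq'
  clear h
  induction k with
  | zero => simpa
  | succ k ih =>
    rw [pow_succ', Equiv.Perm.mul_apply]
    exact hP _ ih

theorem isNC_of_nested {n : ℕ} {σ : Equiv.Perm (Fin n)}
    (exc : ∀ i x, i < x → x < σ i → i < σ x ∧ σ x < σ i)
    (ret : ∀ i x, σ i ≤ x → x < i → σ i < σ x ∧ σ x ≤ i) : IsNC σ := by
  have hσ : ∀ x, σ.SameCycle x (σ x) := fun x => (Equiv.Perm.SameCycle.refl σ x).apply_right
  have hexc : ∀ {i x y}, σ.SameCycle x y → i < x → x < σ i → i < y ∧ y < σ i :=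
    fun {i x y} hxy h1 h2 => sameCycle_induction (P := fun y => i < y ∧ y < σ i)
      (fun z hz => exc i z hz.1 hz.2) hxy ⟨h1, h2⟩
  have hret : ∀ {i y}, σ.SameCycle i y → σ i ≤ i → σ i ≤ y ∧ y ≤ i := by
    intro i y hy hi
    refine sameCycle_induction (P := fun y => σ i ≤ y ∧ y ≤ i) (fun z hz => ?_) hy ⟨hi, le_rfl⟩
    rcases lt_or_eq_of_le hz.2 with h | rfl
    · exact ⟨(ret i z hz.1 h).1.le, (ret i z hz.1 h).2⟩
    · exact ⟨le_rfl, hi⟩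
  have hinc : IncCycles σ := by
    intro x
    have hnext : ∀ y, σ.SameCycle x y → x < y → σ x ≤ y := by
      intro y hy hxy
      by_contra hlt
      exact absurd (hexc hy.symm hxy (not_le.1 hlt)).1 (lt_irrefl x)
    refine ⟨?_, fun hmax y hy => (hret hy (hmax _ (hσ x))).1⟩
    rintro ⟨y, hy, hxy⟩
    refine ⟨?_, hnext⟩
    by_contra hle
    exact absurd (hret hy (not_lt.1 hle)).2 (not_le.2 hxy)
  refine ⟨hinc, ?_⟩
  rintro ⟨a, b, c, d, hab, hbc, hcd, hac, hbd, hnab⟩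
  obtain ⟨a', ha', hmax⟩ := (Finset.univ.filter fun z => σ.SameCycle a z ∧ z < b).exists_max_image
    id ⟨a, by simp [hab, Equiv.Perm.SameCycle.refl]⟩
  simp only [Finset.mem_filter, Finset.mem_univ, true_and, id] at ha' hmax
  have hc := ((hinc a').1 ⟨c, ha'.1.symm.trans hac, ha'.2.trans hbc⟩)
  have hle := hc.2 c (ha'.1.symm.trans hac) (ha'.2.trans hbc)
  have hsa := ha'.1.trans (hσ a')
  have hb : b < σ a' := by
    by_contra hcon
    rcases lt_or_eq_of_le (not_lt.1 hcon) with h | h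
    · exact absurd (hmax _ ⟨hsa, h⟩) (not_le.2 hc.1)
    · exact hnab (h ▸ hsa)
  exact absurd ((hexc hbd ha'.2 hb).2.trans_le hle) (not_lt.2 hcd.le)

/-! ### The Dyck path of a non-crossing permutation -/

/-- The position in the path of the step recording whether `σ i ≤ i`. -/
def outPos {n : ℕ} (i : Fin n) : ℕ := 2 * (n - 1 - i)

/-- The position in the path of the step recording whether `σ⁻¹ i < i`. -/
def inPos {n : ℕ} (i : Fin n) : ℕ := 2 * (n - 1 - i) + 1

theorem outPos_lt {n : ℕ} (i : Fin n) : outPos i < 2 * n := by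
  unfold outPos
  omega

theorem inPos_lt {n : ℕ} (i : Fin n) : inPos i < 2 * n := by
  unfold inPos
  omega

theorem exists_outPos_or_inPos {n p : ℕ} (hp : p < 2 * n) :
    ∃ i : Fin n, p = outPos i ∨ p = inPos i := by
  refine ⟨⟨n - 1 - p / 2, by omega⟩, ?_⟩
  simp only [outPos, inPos]
  omega

/-- The path of a permutation `σ`, read from the largest element to the smallest. -/
def permPath {n : ℕ} (σ : Equiv.Perm (Fin n)) (t : Fin (2 * n)) : Bool :=
  let x : Fin n := ⟨n - 1 - t / 2, by omega⟩
  if (t : ℕ) % 2 = 0 then decide (σ x ≤ x) else decide (σ⁻¹ x < x)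

theorem permPath_outPos {n : ℕ} (σ : Equiv.Perm (Fin n)) (i : Fin n) (h : outPos i < 2 * n) :
    permPath σ ⟨outPos i, h⟩ = decide (σ i ≤ i) := by
  have : (⟨n - 1 - outPos i / 2, by omega⟩ : Fin n) = i := Fin.ext (by simp [outPos]; omega)
  simp only [permPath, this]
  simp [outPos]

theorem permPath_inPos {n : ℕ} (σ : Equiv.Perm (Fin n)) (i : Fin n) (h : inPos i < 2 * n) :
    permPath σ ⟨inPos i, h⟩ = decide (σ⁻¹ i < i) := by
  have : (⟨n - 1 - inPos i / 2, by omega⟩ : Fin n) = i := Fin.ext (by simp [inPos]; omega)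
  simp only [permPath, this]
  simp [inPos]

theorem hasLetter_outPos {n : ℕ} {σ : Equiv.Perm (Fin n)} {i : Fin n} {b : Bool} :
    HasLetter (permPath σ) b (outPos i) ↔ decide (σ i ≤ i) = b := by
  simp [HasLetter, permPath_outPos, outPos_lt]

theorem hasLetter_inPos {n : ℕ} {σ : Equiv.Perm (Fin n)} {i : Fin n} {b : Bool} :
    HasLetter (permPath σ) b (inPos i) ↔ decide (σ⁻¹ i < i) = b := by
  simp [HasLetter, permPath_inPos, inPos_lt]

/-- The matching joining the out-position of each `i` to the in-position of `σ i`. -/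
def PermArc {n : ℕ} (σ : Equiv.Perm (Fin n)) (p q : ℕ) : Prop :=
  ∃ i, (σ i ≤ i ∧ p = outPos i ∧ q = inPos (σ i)) ∨ (i < σ i ∧ p = inPos (σ i) ∧ q = outPos i)

theorem outPos_inj {n : ℕ} {i j : Fin n} (h : outPos i = outPos j) : i = j := by
  simp only [outPos] at h
  omega

theorem inPos_inj {n : ℕ} {i j : Fin n} (h : inPos i = inPos j) : i = j := by
  simp only [inPos] at h
  omega

theorem outPos_ne_inPos {n : ℕ} (i j : Fin n) : outPos i ≠ inPos j := by
  simp only [outPos, inPos]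
  omega

theorem ArcsNested.isNCMatching {n : ℕ} {σ : Equiv.Perm (Fin n)} (h : ArcsNested σ) :
    IsNCMatching (HasLetter (permPath σ) true) (HasLetter (permPath σ) false) (PermArc σ) where
  lt := by
    rintro p q ⟨i, ⟨hi, rfl, rfl⟩ | ⟨hi, rfl, rfl⟩⟩ <;> simp only [outPos, inPos] <;> omega
  right_unique := by
    rintro p q q' ⟨i, ⟨-, rfl, rfl⟩ | ⟨-, rfl, rfl⟩⟩ ⟨j, ⟨-, h, rfl⟩ | ⟨-, h, rfl⟩⟩
    · rw [outPos_inj h]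
    · exact absurd h (outPos_ne_inPos _ _)
    · exact absurd h.symm (outPos_ne_inPos _ _)
    · rw [σ.injective (inPos_inj h)]
  left_unique := by
    rintro p p' q ⟨i, ⟨-, rfl, rfl⟩ | ⟨-, rfl, rfl⟩⟩ ⟨j, ⟨-, rfl, h⟩ | ⟨-, rfl, h⟩⟩
    · rw [σ.injective (inPos_inj h)]
    · exact absurd h.symm (outPos_ne_inPos _ _)
    · exact absurd h (outPos_ne_inPos _ _)
    · rw [outPos_inj h]
  nested := by
    rintro p q p' q' ⟨i, ⟨hi, rfl, rfl⟩ | ⟨hi, rfl, rfl⟩⟩ ⟨j, ⟨hj, rfl, rfl⟩ | ⟨hj, rfl, rfl⟩⟩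
      hp hq <;> simp only [outPos, inPos] at hp hq ⊢
    · have := h.ret (i := i) (x := j) (by omega) (by omega)
      omega
    · have := h.ret_inv (i := i) (x := σ j) (by omega) (by omega)
      rw [Equiv.Perm.inv_def, Equiv.symm_apply_apply] at this
      omega
    · have := h.exc (i := i) (x := j) (by omega) (by omega)
      omega
    · have := h.exc_inv (i := i) (x := σ j) (by omega) (by omega)
      rw [Equiv.Perm.inv_def, Equiv.symm_apply_apply] at this
      omega
  left_iff := by
    intro p
    constructor
    · rintro ⟨q, i, ⟨hi, rfl, -⟩ | ⟨hi, rfl, -⟩⟩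
      · simp [hasLetter_outPos, hi]
      · simp [hasLetter_inPos, hi]
    · intro hp
      obtain ⟨i, rfl | rfl⟩ := exists_outPos_or_inPos hp.1
      · rw [hasLetter_outPos, decide_eq_true_iff] at hp
        exact ⟨_, i, .inl ⟨hp, rfl, rfl⟩⟩
      · rw [hasLetter_inPos, decide_eq_true_iff] at hp
        exact ⟨_, σ⁻¹ i, .inr ⟨by simpa, by simp, rfl⟩⟩
  right_iff := by
    intro p
    constructor
    · rintro ⟨q, i, ⟨hi, -, rfl⟩ | ⟨hi, -, rfl⟩⟩
      · simp [hasLetter_inPos, hi]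
      · simp [hasLetter_outPos, hi]
    · intro hp
      obtain ⟨i, rfl | rfl⟩ := exists_outPos_or_inPos hp.1
      · rw [hasLetter_outPos, decide_eq_false_iff_not, not_le] at hp
        exact ⟨_, i, .inr ⟨hp, rfl, rfl⟩⟩
      · rw [hasLetter_inPos, decide_eq_false_iff_not, not_lt] at hp
        exact ⟨_, σ⁻¹ i, .inl ⟨by simpa, rfl, by simp⟩⟩

theorem IsNCMatching.countE_le_countN {m : ℕ} {w : Fin m → Bool} {A : ℕ → ℕ → Prop}
    (h : IsNCMatching (HasLetter w true) (HasLetter w false) A) (k : ℕ) :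
    countE w k ≤ countN w k := by
  unfold countE countN
  refine Finset.card_le_card_of_forall_subsingleton (fun q p : Fin m => A p q) ?_ ?_
  · intro q hq
    simp only [Finset.mem_filter, Finset.mem_univ, true_and] at hq
    obtain ⟨p, hA⟩ := h.right_iff.2 ⟨q.2, hq.2⟩
    obtain ⟨hp, hw⟩ := h.left_iff.1 ⟨_, hA⟩
    have := h.lt hA
    exact ⟨⟨p, hp⟩, Finset.mem_filter.2 ⟨Finset.mem_univ _, this.trans hq.1, hw⟩, hA⟩
  · rintro p - q ⟨-, hq⟩ q' ⟨-, hq'⟩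
    exact Fin.ext (h.right_unique hq hq')

theorem IsNCMatching.countN_le_countE {m : ℕ} {w : Fin m → Bool} {A : ℕ → ℕ → Prop}
    (h : IsNCMatching (HasLetter w true) (HasLetter w false) A) :
    countN w m ≤ countE w m := by
  unfold countE countN
  refine Finset.card_le_card_of_forall_subsingleton (fun p q : Fin m => A p q) ?_ ?_
  · intro p hp
    simp only [Finset.mem_filter, Finset.mem_univ, true_and] at hp
    obtain ⟨q, hA⟩ := h.left_iff.2 ⟨p.2, hp.2⟩
    obtain ⟨hq, hw⟩ := h.right_iff.1 ⟨_, hA⟩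
    exact ⟨⟨q, hq⟩, by simp [hw], hA⟩
  · rintro q - p ⟨-, hp⟩ p' ⟨-, hp'⟩
    exact Fin.ext (h.left_unique hp hp')

theorem IsNCMatching.isDyckA {n : ℕ} {w : Fin (2 * n) → Bool} {A : ℕ → ℕ → Prop}
    (h : IsNCMatching (HasLetter w true) (HasLetter w false) A) : IsDyckA n w := by
  refine ⟨?_, h.countE_le_countN⟩
  have := countN_add_countE w
  have := h.countE_le_countN (2 * n)
  have := h.countN_le_countE
  omega

theorem permPath_injOn {n : ℕ} {σ τ : Equiv.Perm (Fin n)} (hσ : IsNC σ) (hτ : IsNC τ)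
    (h : permPath σ = permPath τ) : σ = τ := by
  have hA := hσ.arcsNested.isNCMatching
  rw [h] at hA
  have huniq := hA.unique hτ.arcsNested.isNCMatching
  ext i
  congr 1
  rcases le_or_gt (σ i) i with hi | hi
  · obtain ⟨j, ⟨-, h1, h2⟩ | ⟨-, h1, h2⟩⟩ := (huniq _ _).1 ⟨i, .inl ⟨hi, rfl, rfl⟩⟩
    · rw [outPos_inj h1] at h2 ⊢
      exact inPos_inj h2
    · exact absurd h1 (outPos_ne_inPos _ _)
  · obtain ⟨j, ⟨-, h1, h2⟩ | ⟨-, h1, h2⟩⟩ := (huniq _ _).1 ⟨i, .inr ⟨hi, rfl, rfl⟩⟩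
    · exact absurd h1.symm (outPos_ne_inPos _ _)
    · rw [outPos_inj h2] at h1 ⊢
      exact inPos_inj h1

theorem exists_permPath_eq {n : ℕ} {w : Fin (2 * n) → Bool} (hw : IsDyckA n w) :
    ∃ σ : Equiv.Perm (Fin n), IsNC σ ∧ permPath σ = w := by
  have hM := isNCMatching_heightArc hw
  have hex : ∀ i : Fin n, ∃ j : Fin n,
      HeightArc w (outPos i) (inPos j) ∨ HeightArc w (inPos j) (outPos i) := by
    intro i
    have hodd : ∀ {q}, q < 2 * n → q % 2 ≠ outPos i % 2 → ∃ j : Fin n, q = inPos j := by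
      intro q hq hpar
      obtain ⟨j, rfl | rfl⟩ := exists_outPos_or_inPos hq
      · simp [outPos] at hpar
      · exact ⟨j, rfl⟩
    rcases hasLetter_or w (outPos_lt i) with h | h
    · obtain ⟨q, hq⟩ := hM.left_iff.2 h
      obtain ⟨j, rfl⟩ := hodd hq.2.1 hq.parity
      exact ⟨j, .inl hq⟩
    · obtain ⟨p, hp⟩ := hM.right_iff.2 h
      obtain ⟨j, rfl⟩ := hodd (hp.1.trans hp.2.1) hp.parity.symm
      exact ⟨j, .inr hp⟩
  choose f hf using hex
  have hinj : Function.Injective f := by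
    intro i j hij
    rcases hf i with hi | hi <;> rcases hf j with hj | hj <;> rw [← hij] at hj
    · exact outPos_inj (hM.left_unique hi hj)
    · exact ((hM.right_iff.1 ⟨_, hi⟩).not_true (hM.left_iff.1 ⟨_, hj⟩)).elim
    · exact ((hM.right_iff.1 ⟨_, hj⟩).not_true (hM.left_iff.1 ⟨_, hi⟩)).elim
    · exact outPos_inj (hM.right_unique hi hj)
  obtain ⟨σ, rfl⟩ : ∃ σ : Equiv.Perm (Fin n), ⇑σ = f :=
    ⟨Equiv.ofBijective f (Finite.injective_iff_bijective.1 hinj), rfl⟩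
  have hret : ∀ {i}, σ i ≤ i → HeightArc w (outPos i) (inPos (σ i)) := by
    intro i hi
    refine (hf i).resolve_right fun h => ?_
    have := h.1
    simp only [inPos, outPos] at this
    omega
  have hexc : ∀ {i}, i < σ i → HeightArc w (inPos (σ i)) (outPos i) := by
    intro i hi
    refine (hf i).resolve_left fun h => ?_
    have := h.1
    simp only [inPos, outPos] at this
    omega
  refine ⟨σ, isNC_of_nested ?_ ?_, ?_⟩
  · intro i x h1 h2
    have hi := hexc (h1.trans h2)
    have hne : σ x ≠ σ i := fun h => h1.ne' (σ.injective h)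
    rcases le_or_gt (σ x) x with hx | hx
    · have := hM.nested hi (hret hx) (by simp only [inPos, outPos]; omega)
        (by simp only [outPos]; omega)
      simp only [inPos, outPos] at this
      omega
    · refine ⟨h1.trans hx, ?_⟩
      by_contra hcon
      have := hM.nested (hexc hx) hi (by simp only [inPos]; omega)
        (by simp only [inPos, outPos]; omega)
      simp only [outPos] at this
      omega
  · intro i x h1 h2
    have hi := hret (h1.trans h2.le)
    have hne : σ x ≠ σ i := fun h => h2.ne (σ.injective h)
    rcases le_or_gt (σ x) x with hx | hx
    · have := hM.nested hi (hret hx) (by simp only [outPos]; omega)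
        (by simp only [inPos, outPos]; omega)
      simp only [inPos] at this
      omega
    · refine ⟨h1.trans_lt hx, ?_⟩
      by_contra hcon
      have := hM.nested (hexc hx) hi (by simp only [inPos, outPos]; omega)
        (by simp only [outPos]; omega)
      simp only [inPos, outPos] at this
      omega
  · ext t
    obtain ⟨t, ht⟩ := t
    have hval : ∀ b, HasLetter w b t → w ⟨t, ht⟩ = b := fun b hb => hb.2
    obtain ⟨i, rfl | rfl⟩ := exists_outPos_or_inPos ht
    · rw [permPath_outPos]
      rcases le_or_gt (σ i) i with hi | hi
      · rw [hval true (hM.left_iff.1 ⟨_, hret hi⟩), decide_eq_true hi]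
      · rw [hval false (hM.right_iff.1 ⟨_, hexc hi⟩), decide_eq_false (not_le.2 hi)]
    · rw [permPath_inPos]
      obtain ⟨j, rfl⟩ := σ.surjective i
      rw [Equiv.Perm.inv_def, Equiv.symm_apply_apply]
      rcases le_or_gt (σ j) j with hj | hj
      · rw [hval false (hM.right_iff.1 ⟨_, hret hj⟩), decide_eq_false (not_lt.2 hj)]
      · rw [hval true (hM.left_iff.1 ⟨_, hexc hj⟩), decide_eq_true hj]

/-! ### Descents -/

/-- The elements of the cycles of `σ` that are neither minimal nor maximal. -/
noncomputable def transients {n : ℕ} (σ : Equiv.Perm (Fin n)) : Finset (Fin n) :=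
  Finset.univ.filter fun x => σ⁻¹ x < x ∧ x < σ x

/-- The minimal elements of the cycles of `σ` that come right after a maximal element. -/
noncomputable def restarts {n : ℕ} (σ : Equiv.Perm (Fin n)) : Finset (Fin n) :=
  Finset.univ.filter fun x => x ≤ σ⁻¹ x ∧ ∃ y : Fin n, (y : ℕ) + 1 = x ∧ σ y ≤ y

theorem mem_transients {n : ℕ} {σ : Equiv.Perm (Fin n)} {x : Fin n} :
    x ∈ transients σ ↔ σ⁻¹ x < x ∧ x < σ x := by
  simp [transients]

theorem mem_restarts_of_succ {n : ℕ} {σ : Equiv.Perm (Fin n)} {x y : Fin n}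
    (h : (y : ℕ) + 1 = x) : x ∈ restarts σ ↔ x ≤ σ⁻¹ x ∧ σ y ≤ y := by
  simp only [restarts, Finset.mem_filter, Finset.mem_univ, true_and]
  refine and_congr_right fun _ => ⟨?_, fun h' => ⟨y, h, h'⟩⟩
  rintro ⟨z, hz, hz'⟩
  obtain rfl : z = y := Fin.ext (by omega)
  exact hz'

theorem restarts_pos {n : ℕ} {σ : Equiv.Perm (Fin n)} {x : Fin n} (h : x ∈ restarts σ) :
    1 ≤ (x : ℕ) := by
  simp only [restarts, Finset.mem_filter, Finset.mem_univ, true_and] at h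
  obtain ⟨-, y, hy, -⟩ := h
  omega

theorem exists_succ {n i : ℕ} (h : i ∈ Finset.Ico 1 n) :
    ∃ y x : Fin n, (y : ℕ) + 1 = x ∧ (x : ℕ) = i := by
  rw [Finset.mem_Ico] at h
  exact ⟨⟨i - 1, by omega⟩, ⟨i, by omega⟩, by simp; omega, rfl⟩

theorem mem_permDes_of_succ {n : ℕ} {σ : Equiv.Perm (Fin n)} {x y : Fin n}
    (h : (y : ℕ) + 1 = x) : (x : ℕ) ∈ permDes σ ↔ σ x < σ y := by
  have hy : (⟨(x : ℕ) - 1, by omega⟩ : Fin n) = y := Fin.ext (by simp; omega)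
  simp only [permDes, Finset.mem_filter, Finset.mem_Ico, hy]
  constructor
  · rintro ⟨-, _, h'⟩
    exact h'
  · exact fun h' => ⟨by omega, x.2, h'⟩

theorem permDes_subset {n : ℕ} (σ : Equiv.Perm (Fin n)) : permDes σ ⊆ Finset.Ico 1 n :=
  Finset.filter_subset _ _

theorem ArcsNested.lt_iff {n : ℕ} {σ : Equiv.Perm (Fin n)} (h : ArcsNested σ) {x y : Fin n}
    (hxy : (y : ℕ) + 1 = x) : σ y < σ x ↔ x ∈ transients σ ∨ x ∈ restarts σ := by
  rw [mem_transients, mem_restarts_of_succ hxy]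
  obtain ⟨z, rfl⟩ := σ.surjective x
  rw [Equiv.Perm.inv_def, Equiv.symm_apply_apply]
  have hyx : y < σ z := by omega
  have hne : σ y ≠ σ (σ z) := fun e => hyx.ne (σ.injective e)
  rcases le_or_gt (σ y) y with hy | hy
  · have h1 : σ (σ z) ≤ y → σ (σ z) < σ y := fun hx => (h.ret hx hyx).1
    have h2 : σ z < z → σ z < σ (σ z) := fun hx => (h.ret le_rfl hx).1
    have hz : σ (σ z) = σ z → σ z = z := fun e => σ.injective e
    have hz' : z = σ z → σ (σ z) = σ z := fun e => congrArg σ e.symm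
    omega
  · have h1 : z < y → σ y < σ z := fun hx => (h.exc hx hyx).2
    have h2 : σ z < σ y → σ (σ z) < σ y := fun hx => (h.exc hyx hx).2
    have hz : z = y → σ z = σ y := congrArg σ
    have hz' : σ y = σ z → y = z := fun e => σ.injective e
    omega

theorem ArcsNested.inv_lt_iff {n : ℕ} {σ : Equiv.Perm (Fin n)} (h : ArcsNested σ) {x y : Fin n}
    (hxy : (y : ℕ) + 1 = x) : σ⁻¹ y < σ⁻¹ x ↔ y ∈ transients σ ∨ x ∈ restarts σ := by
  rw [mem_transients, mem_restarts_of_succ hxy]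
  obtain ⟨z, rfl⟩ := σ.surjective x
  obtain ⟨v, rfl⟩ := σ.surjective y
  have hinv : ∀ a, σ⁻¹ (σ a) = a := fun a => by simp
  simp only [hinv]
  have hyx : σ v < σ z := by omega
  have hne : v ≠ z := fun e => hyx.ne (congrArg σ e)
  have hv : v = σ v → σ v = σ (σ v) := congrArg σ
  have hv' : σ (σ v) = σ v → σ v = v := fun e => σ.injective e
  rcases le_or_gt (σ z) z with hz | hz
  · have h1 : σ (σ v) < σ v → v < σ v := fun hx => by
      simpa only [hinv] using (h.ret_inv hx le_rfl).2
    have h2 : σ z ≤ v → z < v := fun hx => by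
      simpa only [hinv] using (h.ret_inv hyx hx).2
    omega
  · have h1 : z < σ v → σ (σ v) < σ z := fun hx => (h.exc hx hyx).2
    have h2 : v < z → z < σ v → σ z < σ v := fun hx hx' => (h.exc hx hx').2
    have hzv : z = σ v → σ z = σ (σ v) := congrArg σ
    have hzv' : σ (σ v) = σ z → σ v = z := fun e => σ.injective e
    omega

theorem sum_permDes_add_sum {n : ℕ} (σ : Equiv.Perm (Fin n)) (s : Finset ℕ)
    (hs : s ⊆ Finset.Ico 1 n) (h : ∀ x y : Fin n, (y : ℕ) + 1 = x → (σ y < σ x ↔ (x : ℕ) ∈ s))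
    (f : ℕ → ℕ) : ∑ i ∈ permDes σ, f i + ∑ i ∈ s, f i = ∑ i ∈ Finset.Ico 1 n, f i := by
  have hsdiff : permDes σ = Finset.Ico 1 n \ s := by
    ext i
    rw [Finset.mem_sdiff]
    refine ⟨fun hi => ⟨permDes_subset σ hi, ?_⟩, fun ⟨hi, hi'⟩ => ?_⟩
    · obtain ⟨y, x, hxy, rfl⟩ := exists_succ (permDes_subset σ hi)
      rw [← h x y hxy]
      exact ((mem_permDes_of_succ hxy).1 hi).not_gt
    · obtain ⟨y, x, hxy, rfl⟩ := exists_succ hi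
      rw [← h x y hxy, not_lt] at hi'
      refine (mem_permDes_of_succ hxy).2 (lt_of_le_of_ne hi' fun e => ?_)
      have := σ.injective e
      omega
  rw [hsdiff, Finset.sum_sdiff hs]

theorem ArcsNested.sum_permDes {n : ℕ} {σ : Equiv.Perm (Fin n)} (h : ArcsNested σ) (f : ℕ → ℕ) :
    ∑ i ∈ permDes σ, f i + (∑ x ∈ transients σ, f x + ∑ x ∈ restarts σ, f x) =
      ∑ i ∈ Finset.Ico 1 n, f i := by
  have hdisj : Disjoint (transients σ) (restarts σ) := by
    rw [Finset.disjoint_left]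
    intro x hx hx'
    exact absurd (mem_transients.1 hx).1 (not_lt.2 (Finset.mem_filter.1 hx').2.1)
  rw [← Finset.sum_union hdisj,
    ← Finset.sum_image (f := f) (g := fun x : Fin n => (x : ℕ)) fun a _ b _ e => Fin.ext e]
  refine sum_permDes_add_sum σ _ ?_ ?_ f
  · intro i hi
    obtain ⟨x, hx, rfl⟩ := Finset.mem_image.1 hi
    rw [Finset.mem_Ico]
    rcases Finset.mem_union.1 hx with hx | hx
    · have := (mem_transients.1 hx).1
      omega
    · have := restarts_pos hx
      omega
  · intro x y hxy
    rw [h.lt_iff hxy, Finset.mem_image]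
    constructor
    · exact fun hx => ⟨x, Finset.mem_union.2 hx, rfl⟩
    · rintro ⟨x', hx', e⟩
      exact Fin.ext e ▸ Finset.mem_union.1 hx'

theorem ArcsNested.sum_permDes_inv {n : ℕ} {σ : Equiv.Perm (Fin n)} (h : ArcsNested σ)
    (f : ℕ → ℕ) :
    ∑ i ∈ permDes σ⁻¹, f i + (∑ x ∈ transients σ, f (x + 1) + ∑ x ∈ restarts σ, f x) =
      ∑ i ∈ Finset.Ico 1 n, f i := by
  have hdisj : Disjoint ((transients σ).image fun x : Fin n => (x : ℕ) + 1)
      ((restarts σ).image fun x : Fin n => (x : ℕ)) := by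
    rw [Finset.disjoint_left]
    intro i hi hi'
    obtain ⟨y, hy, rfl⟩ := Finset.mem_image.1 hi
    obtain ⟨x, hx, e⟩ := Finset.mem_image.1 hi'
    exact absurd (mem_transients.1 hy).2 (not_lt.2 ((mem_restarts_of_succ e.symm).1 hx).2)
  rw [← Finset.sum_image (f := f) (g := fun x : Fin n => (x : ℕ)) fun a _ b _ e => Fin.ext e,
    ← Finset.sum_image (f := f) (g := fun x : Fin n => (x : ℕ) + 1)
      fun a _ b _ e => Fin.ext (Nat.succ_injective e), ← Finset.sum_union hdisj]
  refine sum_permDes_add_sum σ⁻¹ _ ?_ ?_ f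
  · intro i hi
    rw [Finset.mem_Ico]
    rcases Finset.mem_union.1 hi with hi | hi <;> obtain ⟨x, hx, rfl⟩ := Finset.mem_image.1 hi
    · have := (mem_transients.1 hx).2
      omega
    · have := restarts_pos hx
      omega
  · intro x y hxy
    rw [h.inv_lt_iff hxy, Finset.mem_union, Finset.mem_image, Finset.mem_image]
    refine or_congr ⟨fun hy => ⟨y, hy, hxy⟩, ?_⟩ ⟨fun hx => ⟨x, hx, rfl⟩, ?_⟩
    · rintro ⟨y', hy', e⟩
      obtain rfl : y' = y := Fin.ext (by omega)
      exact hy'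
    · rintro ⟨x', hx', e⟩
      exact Fin.ext e ▸ hx'

theorem sum_pathDes_permPath {n : ℕ} (σ : Equiv.Perm (Fin n)) (f : ℕ → ℕ) :
    ∑ i ∈ pathDes (permPath σ), f i =
      ∑ x ∈ transients σ, f (inPos x) + ∑ x ∈ restarts σ, f (outPos x + 2) := by
  have h1 : Set.InjOn (inPos (n := n)) (transients σ) := fun a _ b _ e => inPos_inj e
  have h2 : Set.InjOn (fun x : Fin n => outPos x + 2) (restarts σ) :=
    fun a _ b _ e => outPos_inj (by simpa using e)
  rw [← Finset.sum_image (f := f) h1, ← Finset.sum_image (f := f) h2, ← Finset.sum_union]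
  · congr 1
    ext i
    have hmem : i ∈ pathDes (permPath σ) ↔
        0 < i ∧ HasLetter (permPath σ) false (i - 1) ∧ HasLetter (permPath σ) true i := by
      simp only [pathDes, Finset.mem_filter, Finset.mem_Ioo, HasLetter]
      constructor
      · rintro ⟨h, h', h1, h2⟩
        exact ⟨h.1, ⟨_, h1⟩, ⟨_, h2⟩⟩
      · rintro ⟨h, ⟨_, h1⟩, ⟨h', h2⟩⟩
        exact ⟨⟨h, h'⟩, h', h1, h2⟩
    rw [hmem, Finset.mem_union, Finset.mem_image, Finset.mem_image]
    have hin : ∀ x : Fin n, inPos x - 1 = outPos x := fun x => rfl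
    have hout : ∀ x y : Fin n, (y : ℕ) + 1 = x → outPos x + 2 - 1 = inPos x ∧
        outPos x + 2 = outPos y := fun x y hxy => by
      simp only [inPos, outPos]
      omega
    constructor
    · rintro ⟨hpos, hE, hN⟩
      obtain ⟨y, rfl | rfl⟩ := exists_outPos_or_inPos hN.1
      · have hlt : (y : ℕ) + 1 < n := by
          simp only [outPos] at hpos
          omega
        have hx : (y : ℕ) + 1 = (⟨y + 1, hlt⟩ : Fin n) := rfl
        obtain ⟨e1, e2⟩ := hout _ _ hx
        rw [← e2, e1, hasLetter_inPos, decide_eq_false_iff_not, not_lt] at hE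
        rw [hasLetter_outPos, decide_eq_true_iff] at hN
        exact .inr ⟨_, (mem_restarts_of_succ hx).2 ⟨hE, hN⟩, e2⟩
      · rw [hin, hasLetter_outPos, decide_eq_false_iff_not, not_le] at hE
        rw [hasLetter_inPos, decide_eq_true_iff] at hN
        exact .inl ⟨y, mem_transients.2 ⟨hN, hE⟩, rfl⟩
    · rintro (⟨x, hx, rfl⟩ | ⟨x, hx, rfl⟩)
      · rw [mem_transients] at hx
        refine ⟨Nat.succ_pos _, ?_, ?_⟩
        · rw [hin, hasLetter_outPos, decide_eq_false_iff_not, not_le]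
          exact hx.2
        · rw [hasLetter_inPos, decide_eq_true_iff]
          exact hx.1
      · obtain ⟨-, y, hy, -⟩ := (Finset.mem_filter.1 hx).2
        obtain ⟨e1, e2⟩ := hout x y hy
        rw [mem_restarts_of_succ hy] at hx
        refine ⟨Nat.succ_pos _, ?_, ?_⟩
        · rw [e1, hasLetter_inPos, decide_eq_false_iff_not, not_lt]
          exact hx.1
        · rw [e2, hasLetter_outPos, decide_eq_true_iff]
          exact hx.2
  · rw [Finset.disjoint_left]
    intro i hi hi'
    rw [Finset.mem_image] at hi hi'
    obtain ⟨x, -, rfl⟩ := hi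
    obtain ⟨y, -, e⟩ := hi'
    simp only [inPos, outPos] at e
    omega

theorem desPath_add_desP {n : ℕ} {σ : Equiv.Perm (Fin n)} (h : ArcsNested σ) :
    desPath (permPath σ) + desP σ = n - 1 := by
  have h1 := sum_pathDes_permPath σ fun _ => 1
  have h2 := h.sum_permDes fun _ => 1
  simp only [Finset.sum_const, smul_eq_mul, mul_one, Nat.card_Ico] at h1 h2
  unfold desPath desP
  omega

theorem majA_add_majP_add_imajP {n : ℕ} {σ : Equiv.Perm (Fin n)} (h : ArcsNested σ) :
    majA n (permPath σ) + majP σ + imajP σ = n * (n - 1) := by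
  have h1 := sum_pathDes_permPath σ fun i => 2 * n - i
  have h2 := h.sum_permDes fun i => i
  have h3 := h.sum_permDes_inv fun i => i
  have h4 : ∑ x ∈ transients σ, (2 * n - inPos x) =
      ∑ x ∈ transients σ, (x : ℕ) + ∑ x ∈ transients σ, ((x : ℕ) + 1) := by
    rw [← Finset.sum_add_distrib]
    refine Finset.sum_congr rfl fun x _ => ?_
    simp only [inPos]
    omega
  have h5 : ∑ x ∈ restarts σ, (2 * n - (outPos x + 2)) =
      ∑ x ∈ restarts σ, (x : ℕ) + ∑ x ∈ restarts σ, (x : ℕ) := by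
    rw [← Finset.sum_add_distrib]
    refine Finset.sum_congr rfl fun x hx => ?_
    simp only [outPos]
    have := restarts_pos hx
    omega
  have h6 : (∑ i ∈ Finset.Ico 1 n, i) * 2 = n * (n - 1) := by
    rw [← Finset.sum_range_id_mul_two, Finset.range_eq_Ico]
    rcases Nat.eq_zero_or_pos n with rfl | hn
    · simp
    · rw [Finset.sum_eq_sum_Ico_succ_bot hn]
      simp
  unfold majA imajP majP
  omega

/-- For every `n ≥ 1` there is a bijection `φ` from Dyck paths of length `n`
onto non-crossing permutations of `{1,…,n}` such that
`des(w) + des(φ(w)) = n - 1` and `maj(w) + maj(φ(w)) + imaj(φ(w)) = n(n-1)`. -/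
theorem exists_bijection_des_maj (n : ℕ) (hn : 1 ≤ n) :
    ∃ φ : {w : Fin (2 * n) → Bool // IsDyckA n w} → {σ : Equiv.Perm (Fin n) // IsNC σ},
      Function.Bijective φ ∧ ∀ w,
        desPath w.1 + desP (φ w).1 = n - 1 ∧
        majA n w.1 + majP (φ w).1 + imajP (φ w).1 = n * (n - 1) := by
  let ψ : {σ : Equiv.Perm (Fin n) // IsNC σ} → {w : Fin (2 * n) → Bool // IsDyckA n w} :=
    fun σ => ⟨permPath σ.1, σ.2.arcsNested.isNCMatching.isDyckA⟩
  have hψ : Function.Bijective ψ := by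
    refine ⟨fun σ τ h => Subtype.ext (permPath_injOn σ.2 τ.2 (congrArg Subtype.val h)), ?_⟩
    rintro ⟨w, hw⟩
    obtain ⟨σ, hσ, rfl⟩ := exists_permPath_eq hw
    exact ⟨⟨σ, hσ⟩, rfl⟩
  refine ⟨(Equiv.ofBijective ψ hψ).symm, Equiv.bijective _, fun w => ?_⟩
  obtain ⟨σ, rfl⟩ := hψ.2 w
  rw [Equiv.ofBijective_symm_apply_apply]
  exact ⟨desPath_add_desP σ.2.arcsNested, majA_add_majP_add_imajP σ.2.arcsNested⟩

end Stmt
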